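/- Let k, ϑ ∈ ℝ and a ∈ ℝ, and let Υ be the 8×8 real matrix with rows (0,−1,0,0,0,0,0,0), (ϑ,k,1,0,0,0,0,0), (0,0,0,−1,0,0,0,0), (0,0,ϑ,k,0,0,0,−a), (−2,0,0,0,0,−ϑ,0,0), (0,0,0,0,1,−k,0,0), (0,0,0,0,0,−1,0,−ϑ), (0,0,0,0,0,0,1,−k). Then the characteristic polynomial of Υ is (X² − kX + ϑ)²·(X² + kX + ϑ)² + 2a; equivalently, every eigenvalue y of Υ satisfies (y² − ky + ϑ)²(y² + ky + ϑ)² + 2a = 0. -/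

import Mathlib

open Polynomial

/-- The 8×8 matrix `Υ` arising from the pair `(Ψ₁, Ψ₂)` of linear matrix equations in the
Laplace-transform computation. -/
def Upsilon (k ϑ a : ℝ) : Matrix (Fin 8) (Fin 8) ℝ :=
  !![0, -1, 0, 0, 0, 0, 0, 0;
     ϑ, k, 1, 0, 0, 0, 0, 0;
     0, 0, 0, -1, 0, 0, 0, 0;
     0, 0, ϑ, k, 0, 0, 0, -a;
     -2, 0, 0, 0, 0, -ϑ, 0, 0;
     0, 0, 0, 0, 1, -k, 0, 0;
     0, 0, 0, 0, 0, -1, 0, -ϑ;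
     0, 0, 0, 0, 0, 0, 1, -k]

set_option maxHeartbeats 4000000 in
theorem det_pencil_Upsilon {R : Type*} [CommRing R] (x k ϑ a : R) :
    !![x, 1, 0, 0, 0, 0, 0, 0;
       -ϑ, x - k, -1, 0, 0, 0, 0, 0;
       0, 0, x, 1, 0, 0, 0, 0;
       0, 0, -ϑ, x - k, 0, 0, 0, a;
       2, 0, 0, 0, x, ϑ, 0, 0;
       0, 0, 0, 0, -1, x + k, 0, 0;
       0, 0, 0, 0, 0, 1, x, ϑ;
       0, 0, 0, 0, 0, 0, -1, x + k].det =
      (x ^ 2 - k * x + ϑ) ^ 2 * (x ^ 2 + k * x + ϑ) ^ 2 + 2 * a := by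
  simp [Matrix.det_succ_row_zero, Fin.sum_univ_succ, Fin.succAbove]
  ring

/-- The characteristic polynomial of `Υ` is `(X² - kX + ϑ)²(X² + kX + ϑ)² + 2a`;
equivalently, every eigenvalue `y` of `Υ` satisfies
`(y² - ky + ϑ)²(y² + ky + ϑ)² + 2a = 0`. -/
theorem charpoly_Upsilon (k ϑ a : ℝ) :
    (Upsilon k ϑ a).charpoly =
      ((X ^ 2 - C k * X + C ϑ) ^ 2 * (X ^ 2 + C k * X + C ϑ) ^ 2 + C (2 * a)) ∧
    ∀ y : ℝ, Module.End.HasEigenvalue (Matrix.toLin' (Upsilon k ϑ a)) y →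
      (y ^ 2 - k * y + ϑ) ^ 2 * (y ^ 2 + k * y + ϑ) ^ 2 + 2 * a = 0 := by
  have hchar : (Upsilon k ϑ a).charpoly =
      (X ^ 2 - C k * X + C ϑ) ^ 2 * (X ^ 2 + C k * X + C ϑ) ^ 2 + C (2 * a) := by
    have hmat : (Upsilon k ϑ a).charmatrix =
        !![X, 1, 0, 0, 0, 0, 0, 0;
           -C ϑ, X - C k, -1, 0, 0, 0, 0, 0;
           0, 0, X, 1, 0, 0, 0, 0;
           0, 0, -C ϑ, X - C k, 0, 0, 0, C a;
           2, 0, 0, 0, X, C ϑ, 0, 0;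
           0, 0, 0, 0, -1, X + C k, 0, 0;
           0, 0, 0, 0, 0, 1, X, C ϑ;
           0, 0, 0, 0, 0, 0, -1, X + C k] := by
      ext1 i j
      fin_cases i <;> fin_cases j <;> simp [Upsilon, C_ofNat]
    rw [Matrix.charpoly, hmat, det_pencil_Upsilon, C_mul, C_ofNat]
  refine ⟨hchar, fun y hy => ?_⟩
  have hroot := (Module.End.hasEigenvalue_iff_isRoot_charpoly _ _).mp hy
  rw [Matrix.charpoly_toLin'] at hroot
  simpa [hchar, IsRoot] using hroot
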